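/- In the Subbotin setting with parameter ζ > 1: (1) there exists a constant C = C(ζ) such that for any integer ρ_n ≥ 1, any n, s_n with n/s_n ≥ C, and any b ∈ ℝ, p_n(b,ρ_n) ≤ F̄(b) + e^{−ρ_n}; (2) for any δ > 0 there exists C = C(δ,ζ) such that for n/s_n ≥ C and any b ∈ ℝ, p_n(b,1) ≤ F̄(b−δ) + exp(−δ (ζ log(n/s_n))^{1−1/ζ}). -/

import Mathlib

open MeasureTheory ProbabilityTheory Filter
open scoped Classical ENNReal

noncomputable section

/-- Unnormalized Subbotin density `e^{-|x|^ζ/ζ}`. -/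
def sDensity (ζ : ℝ) (x : ℝ) : ℝ := Real.exp (-|x| ^ ζ / ζ)

/-- Normalizing constant `L_ζ = ∫ e^{-|x|^ζ/ζ} dx`. -/
def Lz (ζ : ℝ) : ℝ := ∫ x : ℝ, sDensity ζ x

/-- Subbotin density `f(x) = L_ζ⁻¹ e^{-|x|^ζ/ζ}`. -/
def sf (ζ : ℝ) (x : ℝ) : ℝ := (Lz ζ)⁻¹ * sDensity ζ x

/-- Subbotin noise distribution: the measure with density `f` w.r.t. Lebesgue measure. -/
def noiseMeasure (ζ : ℝ) : Measure ℝ :=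
  MeasureTheory.volume.withDensity fun x => ENNReal.ofReal (sf ζ x)

/-- Subbotin upper tail function `F̄(x) = ∫_x^∞ f(u) du`. -/
def Fbar (ζ : ℝ) (x : ℝ) : ℝ := ∫ u in Set.Ioi x, sf ζ u

/-- Law of the observation `X = θ + ε` with `ε_i` i.i.d. Subbotin(ζ) noise. -/
def obsLaw {n : ℕ} (ζ : ℝ) (θ : Fin n → ℝ) : Measure (Fin n → ℝ) :=
  Measure.pi fun i =>
    MeasureTheory.volume.withDensity fun x => ENNReal.ofReal (sf ζ (x - θ i))

/-- Number of rejections of the decision vector `v`. -/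
def numRej {n : ℕ} (v : Fin n → Bool) : ℕ :=
  (Finset.univ.filter fun i => v i = true).card

/-- Support of `θ`. -/
def supp {n : ℕ} (θ : Fin n → ℝ) : Finset (Fin n) :=
  Finset.univ.filter fun i => θ i ≠ 0

/-- False discovery proportion. -/
def FDP {n : ℕ} (θ : Fin n → ℝ) (v : Fin n → Bool) : ℝ :=
  ((Finset.univ.filter fun i => θ i = 0 ∧ v i = true).card : ℝ) / max 1 (numRej v : ℝ)

/-- False negative proportion. -/
def FNP {n : ℕ} (θ : Fin n → ℝ) (v : Fin n → Bool) : ℝ :=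
  ((Finset.univ.filter fun i => θ i ≠ 0 ∧ v i = false).card : ℝ) / max 1 ((supp θ).card : ℝ)

/-- False discovery rate. -/
def FDR {n : ℕ} (ζ : ℝ) (θ : Fin n → ℝ) (φ : (Fin n → ℝ) → Fin n → Bool) : ℝ :=
  ∫ x, FDP θ (φ x) ∂(obsLaw ζ θ)

/-- False negative rate. -/
def FNR {n : ℕ} (ζ : ℝ) (θ : Fin n → ℝ) (φ : (Fin n → ℝ) → Fin n → Bool) : ℝ :=
  ∫ x, FNP θ (φ x) ∂(obsLaw ζ θ)

/-- Combined multiple testing risk `𝔎 = FDR + FNR`. -/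
def mtRisk {n : ℕ} (ζ : ℝ) (θ : Fin n → ℝ) (φ : (Fin n → ℝ) → Fin n → Bool) : ℝ :=
  FDR ζ θ φ + FNR ζ θ φ

/-- Oracle threshold `a* = (ζ log(n/s_n))^{1/ζ}`. -/
def astar (ζ : ℝ) (n s : ℕ) : ℝ := (ζ * Real.log ((n : ℝ) / (s : ℝ))) ^ (1 / ζ)

/-- The class `Θ_𝐛`: sparse vectors with `s` coordinates (at distinct positions) whose
absolute values are at least `a* + b_j`, `j = 1, …, s`. -/
def ThetaMult (ζ : ℝ) (n s : ℕ) (b : Fin s → ℝ) : Set (Fin n → ℝ) :=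
  {θ | (supp θ).card ≤ s ∧
    ∃ ι : Fin s → Fin n, Function.Injective ι ∧
      ∀ j, astar ζ n s + b j ≤ |θ (ι j)|}

/-- `Λ_n(𝐛) = s⁻¹ Σ_j F̄(b_j)`. -/
def Lambda (ζ : ℝ) (s : ℕ) (b : Fin s → ℝ) : ℝ := (∑ j, Fbar ζ (b j)) / (s : ℝ)

/-- `p_n(b,ρ) = P(#{2 ≤ i ≤ ⌊n/s⌋ : ε_i > a_b + ε_1} ≥ ρ)` for i.i.d. Subbotin noise,
realised on the product space `ℝ × (Fin (⌊n/s⌋ - 1) → ℝ)` where the first coordinate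
plays the role of `ε_1`. -/
def pn (ζ : ℝ) (n s : ℕ) (b : ℝ) (ρ : ℕ) : ℝ :=
  (((noiseMeasure ζ).prod (Measure.pi fun _ : Fin (n / s - 1) => noiseMeasure ζ))
    {p | ρ ≤ (Finset.univ.filter fun i => astar ζ n s + b + p.1 < p.2 i).card}).toReal

/-- `𝔉̄_n(𝐛,ρ) = s⁻¹ Σ_j p_n(b_j,ρ)`. -/
def Fcal (ζ : ℝ) (n s : ℕ) (b : Fin s → ℝ) (ρ : ℕ) : ℝ :=
  (∑ j, pn ζ n s (b j) ρ) / (s : ℝ)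

/-- `ω_{δ,q} = exp(−(⌊q⌋−1) F̄((ζ log q)^{1/ζ} − δ))`. -/
def omegaDQ (ζ δ q : ℝ) : ℝ :=
  Real.exp (-((⌊q⌋ : ℝ) - 1) * Fbar ζ ((ζ * Real.log q) ^ (1 / ζ) - δ))

lemma sDensity_nonneg (ζ x : ℝ) : 0 ≤ sDensity ζ x := (Real.exp_pos _).le

lemma sDensity_neg (ζ x : ℝ) : sDensity ζ (-x) = sDensity ζ x := by
  simp [sDensity]

lemma Lz_pos {ζ : ℝ} (hζ : 1 < ζ) : 0 < Lz ζ := by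
  have hζ0 : 0 < ζ := by linarith
  have h : Lz ζ = 2 * ∫ x in Set.Ioi (0 : ℝ), Real.exp (-ζ⁻¹ * x ^ ζ) := by
    rw [Lz, ← integral_comp_abs]
    congr 1 with x
    simp only [sDensity]
    congr 1
    ring
  rw [h, integral_exp_neg_mul_rpow hζ0 (inv_pos.2 hζ0)]
  have := Real.Gamma_pos_of_pos (s := 1 / ζ + 1) (by positivity)
  positivity

lemma integrable_sDensity {ζ : ℝ} (hζ : 1 < ζ) : Integrable (sDensity ζ) :=
  not_imp_comm.1 integral_undef (Lz_pos hζ).ne'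

lemma integrable_sf {ζ : ℝ} (hζ : 1 < ζ) : Integrable (sf ζ) :=
  (integrable_sDensity hζ).const_mul _

lemma sf_nonneg {ζ : ℝ} (hζ : 1 < ζ) (x : ℝ) : 0 ≤ sf ζ x :=
  mul_nonneg (inv_pos.2 (Lz_pos hζ)).le (sDensity_nonneg ζ x)

lemma noiseMeasure_real {ζ : ℝ} (hζ : 1 < ζ) {A : Set ℝ} (hA : MeasurableSet A) :
    (noiseMeasure ζ).real A = ∫ x in A, sf ζ x := by
  rw [Measure.real, noiseMeasure, withDensity_apply _ hA,
    integral_eq_lintegral_of_nonneg_ae (ae_of_all _ (sf_nonneg hζ))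
      (integrable_sf hζ).aestronglyMeasurable.restrict]

lemma isProbabilityMeasure_noiseMeasure {ζ : ℝ} (hζ : 1 < ζ) :
    IsProbabilityMeasure (noiseMeasure ζ) := by
  constructor
  have h : (noiseMeasure ζ).real Set.univ = 1 := by
    rw [noiseMeasure_real hζ MeasurableSet.univ, setIntegral_univ]
    simp only [sf]
    rw [integral_const_mul]
    exact inv_mul_cancel₀ (Lz_pos hζ).ne'
  rwa [Measure.real, ENNReal.toReal_eq_one_iff] at h

lemma noiseMeasure_real_Ioi {ζ : ℝ} (hζ : 1 < ζ) (t : ℝ) :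
    (noiseMeasure ζ).real (Set.Ioi t) = Fbar ζ t :=
  noiseMeasure_real hζ measurableSet_Ioi

lemma noiseMeasure_real_Iic_neg {ζ : ℝ} (hζ : 1 < ζ) (t : ℝ) :
    (noiseMeasure ζ).real (Set.Iic (-t)) = Fbar ζ t := by
  rw [noiseMeasure_real hζ measurableSet_Iic, Fbar]
  have h := integral_comp_neg_Iic (-t) (sf ζ)
  rw [neg_neg] at h
  rw [← h]
  simp only [sf, sDensity_neg]

lemma Fbar_nonneg {ζ : ℝ} (hζ : 1 < ζ) (t : ℝ) : 0 ≤ Fbar ζ t :=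
  integral_nonneg fun _ => sf_nonneg hζ _

/-- Convexity of `x ↦ x ^ ζ / ζ`: the graph lies above its tangent at `a`. -/
lemma rpow_div_tangent_le {ζ a u : ℝ} (hζ : 1 < ζ) (ha : 0 < a) (hu : 0 ≤ u) :
    a ^ ζ / ζ + (u - a) * a ^ (ζ - 1) ≤ u ^ ζ / ζ := by
  have hζ0 : 0 < ζ := by linarith
  have hs : -1 ≤ u / a - 1 := by
    have : 0 ≤ u / a := by positivity
    linarith
  have h := one_add_mul_self_le_rpow_one_add hs hζ.le
  rw [add_sub_cancel, Real.div_rpow hu ha.le, le_div_iff₀ (by positivity)] at h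
  rw [Real.rpow_sub_one ha.ne', le_div_iff₀ hζ0]
  refine le_trans (le_of_eq ?_) h
  field_simp

/-- Upper bound on the Subbotin tail, in terms of the tangent of the exponent at `a`. -/
lemma Fbar_add_le {ζ a : ℝ} (hζ : 1 < ζ) (ha : 0 < a) {δ : ℝ} (hδ : 0 ≤ δ) :
    Fbar ζ (a + δ) ≤
      Real.exp (-(a ^ ζ / ζ)) * (Real.exp (-δ * a ^ (ζ - 1)) * (Lz ζ * a ^ (ζ - 1))⁻¹) := by
  have hL := Lz_pos hζ
  have hc : 0 < a ^ (ζ - 1) := by positivity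
  set c := a ^ (ζ - 1)
  set K := (Lz ζ)⁻¹ * Real.exp (-(a ^ ζ / ζ) + a * c) with hK
  have hle : Fbar ζ (a + δ) ≤ ∫ u in Set.Ioi (a + δ), K * Real.exp (-c * u) := by
    refine setIntegral_mono_on (integrable_sf hζ).integrableOn
      ((integrableOn_exp_mul_Ioi (neg_neg_of_pos hc) _).const_mul K) measurableSet_Ioi ?_
    intro u hu
    have hu0 : 0 < u := by have := Set.mem_Ioi.1 hu; linarith
    have h := rpow_div_tangent_le hζ ha hu0.le
    rw [sf, sDensity, abs_of_pos hu0, hK, mul_assoc, ← Real.exp_add]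
    gcongr
    rw [neg_div]
    linarith
  refine hle.trans (le_of_eq ?_)
  rw [integral_const_mul, integral_exp_mul_Ioi (neg_neg_of_pos hc), hK, neg_div_neg_eq, mul_inv]
  have h : Real.exp (-(a ^ ζ / ζ) + a * c) * Real.exp (-c * (a + δ)) =
      Real.exp (-(a ^ ζ / ζ)) * Real.exp (-δ * c) := by
    rw [← Real.exp_add, ← Real.exp_add]
    congr 1
    ring
  rw [← mul_assoc (Real.exp (-(a ^ ζ / ζ))), ← h]
  ring

/-- The number of coordinates exceeding `t` is at least `ρ` with probability at most
`(m μ(t, ∞)) ^ ρ`. -/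
lemma measureReal_pi_le_card_exceed_le (μ : Measure ℝ) [IsProbabilityMeasure μ] (m ρ : ℕ) (t : ℝ) :
    (Measure.pi fun _ : Fin m => μ).real
      {x | ρ ≤ (Finset.univ.filter fun i => t < x i).card} ≤ (m * μ.real (Set.Ioi t)) ^ ρ := by
  have hsub : {x : Fin m → ℝ | ρ ≤ (Finset.univ.filter fun i => t < x i).card} ⊆
      ⋃ S ∈ Finset.powersetCard ρ (Finset.univ : Finset (Fin m)),
        Set.pi Set.univ fun i => if i ∈ S then Set.Ioi t else Set.univ := by
    intro x hx
    obtain ⟨S, hS, hcard⟩ := Finset.exists_subset_card_eq hx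
    simp only [Set.mem_iUnion, Finset.mem_powersetCard]
    refine ⟨S, ⟨Finset.subset_univ _, hcard⟩, fun i _ => ?_⟩
    by_cases hi : i ∈ S
    · simpa [hi] using hS hi
    · simp [hi]
  refine (measureReal_mono hsub (measure_ne_top _ _)).trans
    ((measureReal_biUnion_finset_le _ _).trans ?_)
  have hbox : ∀ S ∈ Finset.powersetCard ρ (Finset.univ : Finset (Fin m)),
      (Measure.pi fun _ : Fin m => μ).real
        (Set.pi Set.univ fun i => if i ∈ S then Set.Ioi t else Set.univ) =
        μ.real (Set.Ioi t) ^ ρ := by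
    intro S hS
    rw [Measure.real, Measure.pi_pi, ENNReal.toReal_prod, ← (Finset.mem_powersetCard.1 hS).2,
      ← Finset.prod_const, ← Finset.prod_subset (Finset.subset_univ S)]
    · exact Finset.prod_congr rfl fun i hi => by simp [hi, Measure.real]
    · intro i _ hi
      simp [hi]
  rw [Finset.sum_congr rfl hbox, Finset.sum_const, Finset.card_powersetCard, Finset.card_univ,
    Fintype.card_fin, nsmul_eq_mul, mul_pow]
  gcongr
  exact_mod_cast Nat.choose_le_pow m ρ

lemma pn_le {ζ : ℝ} (hζ : 1 < ζ) (n s : ℕ) (b δ : ℝ) (ρ : ℕ) :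
    pn ζ n s b ρ ≤
      Fbar ζ (b - δ) + ((n : ℝ) / s * Fbar ζ (astar ζ n s + δ)) ^ ρ := by
  have := isProbabilityMeasure_noiseMeasure hζ
  set P := Measure.pi fun _ : Fin (n / s - 1) => noiseMeasure ζ
  set a := astar ζ n s
  set B : Set (Fin (n / s - 1) → ℝ) :=
    {x | ρ ≤ (Finset.univ.filter fun i => a + δ < x i).card}
  have hsub : {p : ℝ × (Fin (n / s - 1) → ℝ) |
      ρ ≤ (Finset.univ.filter fun i => a + b + p.1 < p.2 i).card} ⊆
      (Set.Iic (-(b - δ)) ×ˢ Set.univ) ∪ (Set.univ ×ˢ B) := by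
    rintro ⟨x, y⟩ hxy
    rcases le_or_gt x (-(b - δ)) with hx | hx
    · exact Or.inl ⟨hx, trivial⟩
    · refine Or.inr ⟨trivial, le_trans hxy (Finset.card_le_card fun i hi => ?_)⟩
      simp only [Finset.mem_filter, Finset.mem_univ, true_and] at hi ⊢
      linarith
  have hm : ((n / s - 1 : ℕ) : ℝ) ≤ (n : ℝ) / s :=
    (Nat.cast_le.2 (Nat.sub_le _ _)).trans Nat.cast_div_le
  calc pn ζ n s b ρ
      ≤ ((noiseMeasure ζ).prod P).real
          ((Set.Iic (-(b - δ)) ×ˢ Set.univ) ∪ (Set.univ ×ˢ B)) := measureReal_mono hsub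
    _ ≤ _ := measureReal_union_le _ _
    _ = Fbar ζ (b - δ) + P.real B := by
      rw [measureReal_prod_prod, measureReal_prod_prod, noiseMeasure_real_Iic_neg hζ]
      simp
    _ ≤ _ := by
      gcongr
      refine (measureReal_pi_le_card_exceed_le _ _ _ _).trans ?_
      rw [noiseMeasure_real_Ioi hζ]
      have := Fbar_nonneg hζ (a + δ)
      gcongr

lemma div_mul_Fbar_astar_add_le {ζ : ℝ} (hζ : 1 < ζ) {n s : ℕ} (h1 : 1 < (n : ℝ) / s) {δ : ℝ}
    (hδ : 0 ≤ δ) :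
    (n : ℝ) / s * Fbar ζ (astar ζ n s + δ) ≤
      Real.exp (-δ * (ζ * Real.log ((n : ℝ) / s)) ^ (1 - 1 / ζ)) *
        (Lz ζ * (ζ * Real.log ((n : ℝ) / s)) ^ (1 - 1 / ζ))⁻¹ := by
  have hζ0 : 0 < ζ := by linarith
  have hlog : 0 < ζ * Real.log ((n : ℝ) / s) := mul_pos hζ0 (Real.log_pos h1)
  have ha : 0 < astar ζ n s := Real.rpow_pos_of_pos hlog _
  have hpow : astar ζ n s ^ (ζ - 1) = (ζ * Real.log ((n : ℝ) / s)) ^ (1 - 1 / ζ) := by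
    rw [astar, ← Real.rpow_mul hlog.le]
    congr 1
    field_simp
  have hexp : Real.exp (-(astar ζ n s ^ ζ / ζ)) = ((n : ℝ) / s)⁻¹ := by
    rw [astar, ← Real.rpow_mul hlog.le, one_div_mul_cancel hζ0.ne', Real.rpow_one,
      mul_div_cancel_left₀ _ hζ0.ne', Real.exp_neg, Real.exp_log (by linarith)]
  have h := Fbar_add_le hζ ha hδ
  rw [hexp, hpow] at h
  have hq : (0 : ℝ) < (n : ℝ) / s := by linarith
  exact (le_inv_mul_iff₀ hq).1 h

/-- Eventually the prefactor of the tail bound falls below any positive level. -/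
lemma exists_forall_inv_Lz_mul_le {ζ : ℝ} (hζ : 1 < ζ) {η : ℝ} (hη : 0 < η) :
    ∃ C : ℝ, ∀ q : ℝ, C ≤ q → 1 < q ∧
      (Lz ζ * (ζ * Real.log q) ^ (1 - 1 / ζ))⁻¹ ≤ η := by
  have hζ0 : 0 < ζ := by linarith
  have hpos : 0 < 1 - 1 / ζ := by
    rw [sub_pos, div_lt_one hζ0]
    exact hζ
  have ht : Tendsto (fun q : ℝ => (Lz ζ * (ζ * Real.log q) ^ (1 - 1 / ζ))⁻¹) atTop (nhds 0) :=
    (((tendsto_rpow_atTop hpos).comp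
      (Real.tendsto_log_atTop.const_mul_atTop hζ0)).const_mul_atTop
        (Lz_pos hζ)).inv_tendsto_atTop
  exact eventually_atTop.1 ((eventually_gt_atTop 1).and (ht.eventually_le_const hη))

theorem statement_17 (ζ : ℝ) (hζ : 1 < ζ) :
    (∃ C : ℝ, ∀ ρ : ℕ, 1 ≤ ρ → ∀ n s : ℕ, 1 ≤ s → s ≤ n →
        C ≤ (n : ℝ) / (s : ℝ) → ∀ b : ℝ,
        pn ζ n s b ρ ≤ Fbar ζ b + Real.exp (-(ρ : ℝ))) ∧
    (∀ δ : ℝ, 0 < δ → ∃ C : ℝ, ∀ n s : ℕ, 1 ≤ s → s ≤ n →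
        C ≤ (n : ℝ) / (s : ℝ) → ∀ b : ℝ,
        pn ζ n s b 1 ≤ Fbar ζ (b - δ) +
          Real.exp (-δ * (ζ * Real.log ((n : ℝ) / (s : ℝ))) ^ (1 - 1 / ζ))) := by
  refine ⟨?_, fun δ hδ => ?_⟩
  · obtain ⟨C, hC⟩ := exists_forall_inv_Lz_mul_le hζ (Real.exp_pos (-1))
    refine ⟨C, fun ρ _ n s _ _ hq b => ?_⟩
    obtain ⟨h1, h2⟩ := hC _ hq
    have h := pn_le hζ n s b 0 ρ
    have h3 := div_mul_Fbar_astar_add_le hζ h1 le_rfl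
    rw [neg_zero, zero_mul, Real.exp_zero, one_mul] at h3
    have h4 : Real.exp (-(ρ : ℝ)) = Real.exp (-1) ^ ρ := by
      rw [← Real.exp_nat_mul, mul_neg_one]
    have h5 := Fbar_nonneg hζ (astar ζ n s + 0)
    rw [sub_zero] at h
    rw [h4]
    refine h.trans ?_
    gcongr
    exact h3.trans h2
  · obtain ⟨C, hC⟩ := exists_forall_inv_Lz_mul_le hζ one_pos
    refine ⟨C, fun n s _ _ hq b => ?_⟩
    obtain ⟨h1, h2⟩ := hC _ hq
    have h := pn_le hζ n s b δ 1
    rw [pow_one] at h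
    refine h.trans ?_
    gcongr
    exact (div_mul_Fbar_astar_add_le hζ h1 hδ.le).trans
      (mul_le_of_le_one_right (Real.exp_pos _).le h2)
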